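/- arXiv:2206.04304 — 2 statements merged into one kernel-verified Lean document; each statement's English description precedes it below -/
import Mathlib

section
/- Let x, y, m be real numbers (all logarithms natural). If x > 1, y > e, log x > 1 + (log log y)/(log y), and m > (log y + log log y)/(log x), then x^m / m > y. -/
/-- If `x > 1`, `y > e`, `log x > 1 + (log log y)/(log y)` and
`m > (log y + log log y)/(log x)`, then `x^m / m > y`. -/
theorem rpow_div_gt (x y m : ℝ) (hx : 1 < x) (hy : Real.exp 1 < y)
    (hlog : 1 + Real.log (Real.log y) / Real.log y < Real.log x)
    (hm : (Real.log y + Real.log (Real.log y)) / Real.log x < m) :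
    y < x ^ m / m := by
  have hy0 : 0 < y := (Real.exp_pos 1).trans hy
  have hL : 1 < Real.log y := (Real.lt_log_iff_exp_lt hy0).2 hy
  have hl : 0 < Real.log (Real.log y) := Real.log_pos hL
  have ha : 0 < Real.log x := Real.log_pos hx
  have hm0 : 0 < m := lt_trans (by positivity) hm
  rw [div_lt_iff₀ ha] at hm
  suffices h : Real.log y + Real.log m < Real.log x * m by
    rw [lt_div_iff₀ hm0, Real.rpow_def_of_pos (by linarith),
      ← Real.log_lt_iff_lt_exp (by positivity), Real.log_mul hy0.ne' hm0.ne']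
    exact h
  rcases le_or_gt m (Real.log y) with hmL | hmL
  · linarith [Real.log_le_log hm0 hmL]
  · set L := Real.log y
    have hL0 : 0 < L := by linarith
    have hlogm : Real.log m - Real.log L ≤ m / L - 1 := by
      rw [← Real.log_div hm0.ne' hL0.ne']
      exact Real.log_le_sub_one_of_pos (by positivity)
    have hxm : (1 + Real.log L / L) * m < Real.log x * m := mul_lt_mul_of_pos_right hlog hm0
    have hdiff : (1 + Real.log L / L) * m - L - Real.log L - (m / L - 1)
        = (m - L) * ((L - 1) + Real.log L) / L := by
      field_simp
      ring
    have hpos : 0 < (m - L) * ((L - 1) + Real.log L) / L :=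
      div_pos (mul_pos (by linarith) (by linarith)) hL0
    linarith
end

section
/- Let F be a field and let x, y ∈ F with x ≠ 0, x ≠ 1, y ≠ 0, y ≠ 1, and xy ≠ 1. Let G be the subgroup of the unit group F^× generated by the five elements x, 1−x, y, 1−y, 1−xy. Then each of the five elements t₁ = x, t₂ = y, t₃ = (1−x)/(1−xy), t₄ = 1−xy, t₅ = (1−y)/(1−xy) satisfies tᵢ ≠ 0, tᵢ ≠ 1, and both tᵢ and 1−tᵢ lie in G. In particular (t₁,…,t₅) is a 5-tuple of solutions to the unit equation u + v = 1 with u, v lying in a subgroup of F^× generated by 5 elements (hence of rank at most 5). -/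
/-- If `t` and `1 - t` are both values of units in a subgroup `G`, then `t` is a solution of the
unit equation in `G`; in particular `t ≠ 0` and `t ≠ 1`. -/
theorem unit_equation_solution_of_mem {R : Type*} [Ring R] [Nontrivial R] {G : Subgroup Rˣ}
    {t : R} {u v : Rˣ} (hu : u ∈ G) (hv : v ∈ G) (hut : (u : R) = t) (hvt : (v : R) = 1 - t) :
    t ≠ 0 ∧ t ≠ 1 ∧ (∃ u ∈ G, (u : R) = t) ∧ (∃ u ∈ G, (u : R) = 1 - t) :=
  ⟨hut ▸ u.ne_zero, fun h => v.ne_zero (by rw [hvt, h, sub_self]), ⟨u, hu, hut⟩, ⟨v, hv, hvt⟩⟩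

/-- Let `F` be a field and `x, y ∈ F` with `x ≠ 0, 1`, `y ≠ 0, 1`, `xy ≠ 1`.
Let `G ≤ Fˣ` be the subgroup generated by the five elements
`x, 1−x, y, 1−y, 1−xy`. Then each of the five elements
`x, y, (1−x)/(1−xy), 1−xy, (1−y)/(1−xy)` is `≠ 0`, `≠ 1`, and both it and
its complement to `1` lie in `G`: a rank `≤ 5` 5-tuple of solutions to the
unit equation. -/
theorem unit_equation_family {F : Type*} [Field F] (x y : F)
    (hx0 : x ≠ 0) (hx1 : x ≠ 1) (hy0 : y ≠ 0) (hy1 : y ≠ 1) (hxy : x * y ≠ 1) :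
    ∀ t ∈ ({x, y, (1 - x) / (1 - x * y), 1 - x * y,
        (1 - y) / (1 - x * y)} : Set F),
      t ≠ 0 ∧ t ≠ 1 ∧
      (∃ u ∈ Subgroup.closure {u : Fˣ | (u : F) = x ∨ (u : F) = 1 - x ∨
          (u : F) = y ∨ (u : F) = 1 - y ∨ (u : F) = 1 - x * y}, (u : F) = t) ∧
      (∃ u ∈ Subgroup.closure {u : Fˣ | (u : F) = x ∨ (u : F) = 1 - x ∨
          (u : F) = y ∨ (u : F) = 1 - y ∨ (u : F) = 1 - x * y}, (u : F) = 1 - t) := by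
  have hx : 1 - x ≠ 0 := sub_ne_zero.mpr hx1.symm
  have hy : 1 - y ≠ 0 := sub_ne_zero.mpr hy1.symm
  have hz : 1 - x * y ≠ 0 := sub_ne_zero.mpr hxy.symm
  set S : Set Fˣ := {u : Fˣ | (u : F) = x ∨ (u : F) = 1 - x ∨
    (u : F) = y ∨ (u : F) = 1 - y ∨ (u : F) = 1 - x * y} with hS
  have ha : Units.mk0 x hx0 ∈ Subgroup.closure S := Subgroup.subset_closure (by simp [hS])
  have hb : Units.mk0 (1 - x) hx ∈ Subgroup.closure S := Subgroup.subset_closure (by simp [hS])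
  have hc : Units.mk0 y hy0 ∈ Subgroup.closure S := Subgroup.subset_closure (by simp [hS])
  have hd : Units.mk0 (1 - y) hy ∈ Subgroup.closure S := Subgroup.subset_closure (by simp [hS])
  have he : Units.mk0 (1 - x * y) hz ∈ Subgroup.closure S :=
    Subgroup.subset_closure (by simp [hS])
  rintro t (rfl | rfl | rfl | rfl | rfl)
  · exact unit_equation_solution_of_mem ha hb rfl rfl
  · exact unit_equation_solution_of_mem hc hd rfl rfl
  · refine unit_equation_solution_of_mem (div_mem hb he) (div_mem (mul_mem ha hd) he) (by simp) ?_
    simp only [Units.val_div_eq_div_val, Units.val_mul, Units.val_mk0]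
    rw [one_sub_div hz]
    ring
  · exact unit_equation_solution_of_mem he (mul_mem ha hc) rfl (by simp)
  · refine unit_equation_solution_of_mem (div_mem hd he) (div_mem (mul_mem hc hb) he) (by simp) ?_
    simp only [Units.val_div_eq_div_val, Units.val_mul, Units.val_mk0]
    rw [one_sub_div hz]
    ring
end
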